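/- arXiv:2312.10739 — 7 statements merged into one kernel-verified Lean document; each statement's English description precedes it below -/
import Mathlib

section
/- Let m be a positive natural number, s : Fin m → ℝ, and k a natural number with k ≤ m. Then the supremum of ∑_{i} s i * z i over all z : Fin m → ℝ satisfying 0 ≤ z i ≤ 1 for every i and ∑_i z i = k equals topK(s,k). In other words, the linear-programming relaxation of the binary problem of selecting k coordinates of s with maximum sum is exact. -/
/-- The sum of the `k` largest entries of `s`: the maximum over all subsets
`T` of `Fin m` with `|T| = k` of `∑ i ∈ T, s i`. -/
noncomputable def topK {m : ℕ} (s : Fin m → ℝ) (k : ℕ) : ℝ :=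
  sSup {y : ℝ | ∃ T : Finset (Fin m), T.card = k ∧ ∑ i ∈ T, s i = y}

/-- A set of maximal sum among the sets of its cardinality is separated from its complement
by a threshold. -/
theorem exists_threshold_of_sum_maximal {ι : Type*} [Fintype ι] [DecidableEq ι]
    (s : ι → ℝ) (T : Finset ι)
    (hT : ∀ U : Finset ι, U.card = T.card → ∑ i ∈ U, s i ≤ ∑ i ∈ T, s i) :
    ∃ t : ℝ, (∀ i ∈ T, t ≤ s i) ∧ ∀ j ∉ T, s j ≤ t := by
  rcases T.eq_empty_or_nonempty with rfl | hne
  · obtain ⟨t, ht⟩ := (Set.finite_range s).bddAbove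
    exact ⟨t, by simp, fun j _ => ht ⟨j, rfl⟩⟩
  · obtain ⟨i, hi, hmin⟩ := T.exists_min_image s hne
    refine ⟨s i, hmin, fun j hj => ?_⟩
    have hj' : j ∉ T.erase i := fun h => hj (Finset.mem_of_mem_erase h)
    have h := hT (insert j (T.erase i)) (by
      rw [Finset.card_insert_of_notMem hj', Finset.card_erase_add_one hi])
    rw [Finset.sum_insert hj', ← Finset.add_sum_erase T s hi] at h
    linarith

/-- A set of maximal sum among the sets of its cardinality also bounds all fractional
selections of the same total weight. -/
theorem sum_mul_le_of_sum_maximal {ι : Type*} [Fintype ι] [DecidableEq ι]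
    (s : ι → ℝ) (T : Finset ι)
    (hT : ∀ U : Finset ι, U.card = T.card → ∑ i ∈ U, s i ≤ ∑ i ∈ T, s i)
    (z : ι → ℝ) (hz : ∀ i, 0 ≤ z i ∧ z i ≤ 1) (hsum : ∑ i, z i = (T.card : ℝ)) :
    ∑ i, s i * z i ≤ ∑ i ∈ T, s i := by
  obtain ⟨t, hin, hout⟩ := exists_threshold_of_sum_maximal s T hT
  have hle : ∑ i, (s i - t) * z i ≤ ∑ i, if i ∈ T then s i - t else 0 := by
    refine Finset.sum_le_sum fun i _ => ?_
    split_ifs with hi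
    · exact mul_le_of_le_one_right (sub_nonneg.2 (hin i hi)) (hz i).2
    · exact mul_nonpos_of_nonpos_of_nonneg (sub_nonpos.2 (hout i hi)) (hz i).1
  simp only [sub_mul, Finset.sum_sub_distrib, ← Finset.mul_sum, hsum, Finset.sum_ite_mem,
    Finset.univ_inter, Finset.sum_const, nsmul_eq_mul] at hle
  linarith

/-- The LP relaxation of the problem of selecting the `k` coordinates of `s`
with maximum sum is exact. -/
theorem lp_relaxation_exact (m : ℕ) (hm : 0 < m) (s : Fin m → ℝ) (k : ℕ) (hk : k ≤ m) :
    sSup {y : ℝ | ∃ z : Fin m → ℝ,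
        (∀ i, 0 ≤ z i ∧ z i ≤ 1) ∧ (∑ i, z i) = (k : ℝ) ∧ (∑ i, s i * z i) = y}
      = topK s k := by
  obtain ⟨T, hTmem, hTmax⟩ :=
    (Finset.powersetCard k (Finset.univ : Finset (Fin m))).exists_max_image
      (fun T => ∑ i ∈ T, s i) (Finset.powersetCard_nonempty.2 (by simpa using hk))
  have hTk : T.card = k := (Finset.mem_powersetCard.1 hTmem).2
  have hT : ∀ U : Finset (Fin m), U.card = T.card → ∑ i ∈ U, s i ≤ ∑ i ∈ T, s i := fun U hU =>
    hTmax U (Finset.mem_powersetCard.2 ⟨Finset.subset_univ U, hU.trans hTk⟩)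
  have htop : IsGreatest {y : ℝ | ∃ T : Finset (Fin m), T.card = k ∧ ∑ i ∈ T, s i = y}
      (∑ i ∈ T, s i) := by
    refine ⟨⟨T, hTk, rfl⟩, ?_⟩
    rintro _ ⟨U, hU, rfl⟩
    exact hT U (hU.trans hTk.symm)
  rw [topK, htop.csSup_eq]
  refine IsGreatest.csSup_eq ⟨⟨fun i => if i ∈ T then 1 else 0, fun i => ?_, ?_, ?_⟩, ?_⟩
  · dsimp only
    split_ifs <;> norm_num
  · simp [hTk]
  · simp
  · rintro _ ⟨z, hz, hsum, rfl⟩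
    exact sum_mul_le_of_sum_maximal s T hT z hz (by rw [hsum, hTk])
end

section
/- Let m be a positive natural number, s : Fin m → ℝ, and k a natural number with k ≤ m. Then topK(s,k) equals the infimum over all u ∈ ℝ and v : Fin m → ℝ satisfying v i ≥ 0 and v i + u ≥ s i for every i, of the quantity k * u + ∑_i v i (linear-programming duality for the sum of the k largest entries). -/
/-- Any linearly ordered family on a finite type has a set of `k` indices carrying its `k` largest
values. -/
lemma exists_card_eq_forall_notMem_le {ι α : Type*} [Fintype ι] [LinearOrder α] (s : ι → α)
    {k : ℕ} (hk : k ≤ Fintype.card ι) :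
    ∃ T : Finset ι, T.card = k ∧ ∀ i ∈ T, ∀ j ∉ T, s j ≤ s i := by
  classical
  induction k with
  | zero => exact ⟨∅, by simp⟩
  | succ k ih =>
    obtain ⟨T, hT, h⟩ := ih (by omega)
    have hne : Tᶜ.Nonempty := by
      rw [← Finset.card_pos, Finset.card_compl]
      omega
    obtain ⟨a, ha, hmax⟩ := Finset.exists_max_image Tᶜ s hne
    rw [Finset.mem_compl] at ha
    refine ⟨insert a T, by rw [Finset.card_insert_of_notMem ha, hT], fun i hi j hj ↦ ?_⟩
    rw [Finset.mem_insert, not_or] at hj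
    rcases Finset.mem_insert.1 hi with rfl | hi
    · exact hmax j (Finset.mem_compl.2 hj.2)
    · exact h i hi j hj.2

/-- A set of indices carrying the largest values is separated from its complement by a
threshold. -/
lemma exists_threshold {ι α : Type*} [Fintype ι] [Nonempty ι] [LinearOrder α] {s : ι → α}
    {T : Finset ι} (h : ∀ i ∈ T, ∀ j ∉ T, s j ≤ s i) :
    ∃ u, (∀ i ∈ T, u ≤ s i) ∧ ∀ j ∉ T, s j ≤ u := by
  rcases T.eq_empty_or_nonempty with rfl | hT
  · obtain ⟨a, ha⟩ := Finite.exists_max s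
    exact ⟨s a, by simp, fun j _ ↦ ha j⟩
  · obtain ⟨a, ha, hmin⟩ := Finset.exists_min_image T s hT
    exact ⟨s a, hmin, fun j hj ↦ h a ha j hj⟩

/-- Weak duality for the sum of the `k` largest entries. -/
lemma sum_le_card_mul_add_sum {ι : Type*} [Fintype ι] {s v : ι → ℝ} {u : ℝ}
    (hv : ∀ i, 0 ≤ v i) (hs : ∀ i, s i ≤ v i + u) (T : Finset ι) :
    ∑ i ∈ T, s i ≤ (T.card : ℝ) * u + ∑ i, v i := by
  calc ∑ i ∈ T, s i ≤ ∑ i ∈ T, (v i + u) := Finset.sum_le_sum fun i _ ↦ hs i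
    _ = (T.card : ℝ) * u + ∑ i ∈ T, v i := by
      rw [Finset.sum_add_distrib, Finset.sum_const, nsmul_eq_mul, add_comm]
    _ ≤ (T.card : ℝ) * u + ∑ i, v i := by
      gcongr
      · exact fun i _ _ ↦ hv i
      · exact Finset.subset_univ T

/-- The dual objective at a separating threshold equals the primal objective. -/
lemma card_mul_add_sum_max {ι : Type*} [Fintype ι] {s : ι → ℝ} {u : ℝ} {T : Finset ι}
    (hT : ∀ i ∈ T, u ≤ s i) (hTc : ∀ j ∉ T, s j ≤ u) :
    (T.card : ℝ) * u + ∑ i, max (s i - u) 0 = ∑ i ∈ T, s i := by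
  have hsum : ∑ i, max (s i - u) 0 = ∑ i ∈ T, (s i - u) := by
    rw [← Finset.sum_subset (Finset.subset_univ T)
      fun j _ hj ↦ max_eq_right (sub_nonpos.2 (hTc j hj))]
    exact Finset.sum_congr rfl fun i hi ↦ max_eq_left (sub_nonneg.2 (hT i hi))
  rw [hsum, Finset.sum_sub_distrib, Finset.sum_const, nsmul_eq_mul]
  ring

/-- LP duality for the sum of the `k` largest entries of `s`. -/
theorem topK_eq_dual_inf (m : ℕ) (hm : 0 < m) (s : Fin m → ℝ) (k : ℕ) (hk : k ≤ m) :
    topK s k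
      = sInf {y : ℝ | ∃ (u : ℝ) (v : Fin m → ℝ),
          (∀ i, 0 ≤ v i) ∧ (∀ i, s i ≤ v i + u) ∧ (k : ℝ) * u + ∑ i, v i = y} := by
  have : Nonempty (Fin m) := ⟨⟨0, hm⟩⟩
  obtain ⟨T, rfl, hT⟩ := exists_card_eq_forall_notMem_le s (k := k) (by simpa using hk)
  obtain ⟨u, hu, hu'⟩ := exists_threshold hT
  have hval := card_mul_add_sum_max hu hu'
  have hv : ∀ i, 0 ≤ max (s i - u) 0 := fun i ↦ le_max_right _ _
  have hs : ∀ i, s i ≤ max (s i - u) 0 + u := fun i ↦ sub_le_iff_le_add.1 (le_max_left _ _)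
  have hprimal : IsGreatest {y : ℝ | ∃ S : Finset (Fin m), S.card = T.card ∧ ∑ i ∈ S, s i = y}
      (∑ i ∈ T, s i) := by
    refine ⟨⟨T, rfl, rfl⟩, ?_⟩
    rintro _ ⟨S, hS, rfl⟩
    rw [← hval, ← hS]
    exact sum_le_card_mul_add_sum hv hs S
  have hdual : IsLeast {y : ℝ | ∃ (u : ℝ) (v : Fin m → ℝ),
      (∀ i, 0 ≤ v i) ∧ (∀ i, s i ≤ v i + u) ∧ (T.card : ℝ) * u + ∑ i, v i = y}
      (∑ i ∈ T, s i) := by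
    refine ⟨⟨u, _, hv, hs, hval⟩, ?_⟩
    rintro _ ⟨u', v', hv', hs', rfl⟩
    exact sum_le_card_mul_add_sum hv' hs' T
  rw [topK, hprimal.csSup_eq, hdual.csInf_eq]
end

section
/- Let m be a positive natural number, s : Fin m → ℝ with s i ≥ 0 for every i, and k a natural number with 1 ≤ k ≤ m. Let σ be any permutation of Fin m such that i ↦ s (σ i) is antitone (i.e., s ∘ σ is sorted in nonincreasing order), let u* = s (σ ⟨k-1⟩) be the k-th largest value of s, and let v* i = max (s i − u*) 0. Then u* ≥ 0, v* i ≥ 0 and v* i + u* ≥ s i for every i, and k * u* + ∑_i v* i = topK(s,k); that is, (u*, v*) is an optimal solution of the dual problem min { k u + ∑_i v i : u ≥ 0, v i ≥ 0, v i + u ≥ s i } and its value equals the sum of the k largest entries of s. -/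
/-- Explicit optimal solution of the dual problem: take `u* = s(σ(k-1))`, the
`k`-th largest entry of `s`, and `v* i = max (s i - u*) 0`. Then `(u*, v*)` is
dual feasible (with `u* ≥ 0`) and its value equals the sum of the `k` largest
entries of `s`. -/
theorem dual_optimal_solution (m : ℕ) (hm : 0 < m) (s : Fin m → ℝ)
    (hs : ∀ i, 0 ≤ s i) (k : ℕ) (hk1 : 1 ≤ k) (hkm : k ≤ m)
    (σ : Equiv.Perm (Fin m)) (hσ : Antitone fun i => s (σ i)) :
    letI ustar : ℝ := s (σ ⟨k - 1, by omega⟩)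
    letI vstar : Fin m → ℝ := fun i => max (s i - ustar) 0
    0 ≤ ustar ∧ (∀ i, 0 ≤ vstar i) ∧ (∀ i, s i ≤ vstar i + ustar) ∧
      (k : ℝ) * ustar + ∑ i, vstar i = topK s k := by
  have hk : k - 1 < m := by omega
  change 0 ≤ s (σ ⟨k - 1, hk⟩) ∧ (∀ i, 0 ≤ max (s i - s (σ ⟨k - 1, hk⟩)) 0) ∧
    (∀ i, s i ≤ max (s i - s (σ ⟨k - 1, hk⟩)) 0 + s (σ ⟨k - 1, hk⟩)) ∧
    (k : ℝ) * s (σ ⟨k - 1, hk⟩) + ∑ i, max (s i - s (σ ⟨k - 1, hk⟩)) 0 = topK s k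
  set u := s (σ ⟨k - 1, hk⟩) with hu
  have hle : ∀ i, s i ≤ max (s i - u) 0 + u := fun i => by
    linarith [le_max_left (s i - u) 0]
  refine ⟨hs _, fun i => le_max_right _ _, hle, ?_⟩
  set T : Finset (Fin m) := Finset.univ.map ((Fin.castLEEmb hkm).trans σ.toEmbedding) with hT
  have hT_card : T.card = k := by simp [hT]
  have hT_ge : ∀ i ∈ T, u ≤ s i := by
    intro i hi
    obtain ⟨j, -, rfl⟩ := Finset.mem_map.mp hi
    exact hσ (Fin.mk_le_mk.mpr (Nat.le_sub_one_of_lt j.isLt) : Fin.castLE hkm j ≤ ⟨k - 1, hk⟩)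
  have hT_le : ∀ i, i ∉ T → s i ≤ u := by
    intro i hi
    have hki : k ≤ (σ.symm i : ℕ) := by
      by_contra! h
      exact hi (Finset.mem_map.mpr ⟨⟨σ.symm i, h⟩, Finset.mem_univ _, by
        simp [Fin.castLE]⟩)
    have h : (⟨k - 1, hk⟩ : Fin m) ≤ σ.symm i := Fin.le_def.mpr (by simp only; omega)
    simpa [hu] using hσ h
  have hgreatest : IsGreatest {y : ℝ | ∃ T : Finset (Fin m), T.card = k ∧ ∑ i ∈ T, s i = y}
      ((k : ℝ) * u + ∑ i, max (s i - u) 0) := by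
    constructor
    · refine ⟨T, hT_card, ?_⟩
      have hsum : ∑ i ∈ T, max (s i - u) 0 = ∑ i, max (s i - u) 0 :=
        Finset.sum_subset (Finset.subset_univ T) fun i _ hi =>
          max_eq_right (sub_nonpos.mpr (hT_le i hi))
      rw [← hsum, Finset.sum_congr rfl fun i hi => max_eq_left (sub_nonneg.mpr (hT_ge i hi)),
        Finset.sum_sub_distrib, Finset.sum_const, hT_card, nsmul_eq_mul]
      ring
    · rintro _ ⟨S, hS, rfl⟩
      calc ∑ i ∈ S, s i ≤ ∑ i ∈ S, (max (s i - u) 0 + u) := Finset.sum_le_sum fun i _ => hle i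
        _ = (k : ℝ) * u + ∑ i ∈ S, max (s i - u) 0 := by
          rw [Finset.sum_add_distrib, Finset.sum_const, hS, nsmul_eq_mul, add_comm]
        _ ≤ (k : ℝ) * u + ∑ i, max (s i - u) 0 := by
          gcongr
          exact Finset.subset_univ S
  exact hgreatest.csSup_eq.symm
end

section
/- Let n, m be positive natural numbers, α : Fin m → ℝ a monotone (nondecreasing) weight vector, and f : Fin m → (Fin n → ℝ) an assignment of a vector f i ∈ ℝⁿ to each index i. Define the ordered median function g : (Fin n → ℝ) → ℝ by g(x) = ∑_i α i * y_{(i)}(x), where y_{(1)}(x) ≤ y_{(2)}(x) ≤ ... ≤ y_{(m)}(x) denote the m linear values ⟨f 1, x⟩, ..., ⟨f m, x⟩ sorted in nondecreasing order (e.g., using the monotone sorting permutation of the tuple i ↦ ∑_j f i j * x j). Then g is convex on all of ℝⁿ. -/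
/-- Among all orderings of the values `v`, the sorted one maximizes the weighted sum with
nondecreasing weights `α`. -/
theorem sum_mul_comp_perm_le_sum_mul_comp_sort {m : ℕ} {α : Fin m → ℝ} (hα : Monotone α)
    (v : Fin m → ℝ) (σ : Equiv.Perm (Fin m)) :
    ∑ i, α i * v (σ i) ≤ ∑ i, α i * v (Tuple.sort v i) := by
  have h := (hα.monovary (Tuple.monotone_sort v)).sum_mul_comp_perm_le_sum_mul
    (σ := σ.trans (Tuple.sort v).symm)
  simpa using h

/-- An ordered median function with nondecreasing weights `α`, applied to the
`m` linear values `⟨f i, x⟩` sorted in nondecreasing order, is convex on `ℝⁿ`. -/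
theorem orderedMedian_linear_convex (n m : ℕ) (hn : 0 < n) (hm : 0 < m)
    (α : Fin m → ℝ) (hα : Monotone α) (f : Fin m → Fin n → ℝ) :
    ∀ (x y : Fin n → ℝ) (t : ℝ), 0 ≤ t → t ≤ 1 →
      (∑ i, α i *
          (fun i' => ∑ j, f i' j * (t • x + (1 - t) • y) j)
            (Tuple.sort (fun i' => ∑ j, f i' j * (t • x + (1 - t) • y) j) i))
        ≤ t * (∑ i, α i *
              (fun i' => ∑ j, f i' j * x j)
                (Tuple.sort (fun i' => ∑ j, f i' j * x j) i))
          + (1 - t) * (∑ i, α i *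
              (fun i' => ∑ j, f i' j * y j)
                (Tuple.sort (fun i' => ∑ j, f i' j * y j) i)) := by
  intro x y t ht0 ht1
  have hlin (i' : Fin m) : ∑ j, f i' j * (t • x + (1 - t) • y) j =
      t * ∑ j, f i' j * x j + (1 - t) * ∑ j, f i' j * y j := by
    simp only [Pi.add_apply, Pi.smul_apply, smul_eq_mul, Finset.mul_sum,
      ← Finset.sum_add_distrib]
    exact Finset.sum_congr rfl fun j _ => by ring
  set σ := Tuple.sort (fun i' => ∑ j, f i' j * (t • x + (1 - t) • y) j)
  calc
    _ = t * ∑ i, α i * (∑ j, f (σ i) j * x j) +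
        (1 - t) * ∑ i, α i * (∑ j, f (σ i) j * y j) := by
      simp only [hlin]
      rw [Finset.mul_sum, Finset.mul_sum, ← Finset.sum_add_distrib]
      exact Finset.sum_congr rfl fun i _ => by ring
    _ ≤ _ := add_le_add
      (mul_le_mul_of_nonneg_left (sum_mul_comp_perm_le_sum_mul_comp_sort hα
        (fun i' => ∑ j, f i' j * x j) σ) ht0)
      (mul_le_mul_of_nonneg_left (sum_mul_comp_perm_le_sum_mul_comp_sort hα
        (fun i' => ∑ j, f i' j * y j) σ) (sub_nonneg.mpr ht1))
end

section
/- Let n, m be positive natural numbers, k a natural number with 1 ≤ k ≤ m, s : Fin m → (Fin n → ℝ) score vectors with s i j ≥ 0 for all i, j, x : Fin n → ℝ with x j ≥ 0 for all j, and γ ∈ ℝ. Then topK((fun i => ∑_j s i j * x j), k) ≤ γ holds if and only if there exist u ∈ ℝ and v : Fin m → ℝ with u ≥ 0, v i ≥ 0 and v i + u ≥ ∑_j s i j * x j for every i, such that k u + ∑_i v i ≤ γ. (This justifies the ε-constraint formulation of the sustainability constraint.) -/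
/-- Weak duality: every dual feasible pair bounds the sum of the `k` largest entries. -/
theorem topK_le_of_dual_feasible {m k : ℕ} (hkm : k ≤ m) {y v : Fin m → ℝ} {u : ℝ}
    (hv : ∀ i, 0 ≤ v i) (hyv : ∀ i, y i ≤ v i + u) :
    topK y k ≤ (k : ℝ) * u + ∑ i, v i := by
  apply csSup_le
  · obtain ⟨T, -, hT⟩ := Finset.exists_subset_card_eq
      (s := (Finset.univ : Finset (Fin m))) (by simpa using hkm)
    exact ⟨_, T, hT, rfl⟩
  · rintro _ ⟨T, rfl, rfl⟩
    calc ∑ i ∈ T, y i ≤ ∑ i ∈ T, (v i + u) := Finset.sum_le_sum fun i _ => hyv i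
      _ = (T.card : ℝ) * u + ∑ i ∈ T, v i := by
        rw [Finset.sum_add_distrib, Finset.sum_const, nsmul_eq_mul, add_comm]
      _ ≤ (T.card : ℝ) * u + ∑ i, v i := by
        gcongr
        · exact fun i _ _ => hv i
        · exact Finset.subset_univ T

/-- The sum over any `k`-element subset is at most the sum of the `k` largest entries. -/
theorem sum_le_topK {m : ℕ} (y : Fin m → ℝ) (T : Finset (Fin m)) :
    ∑ i ∈ T, y i ≤ topK y T.card := by
  refine le_csSup ?_ ⟨T, rfl, rfl⟩
  refine ((Set.finite_range fun T : Finset (Fin m) => ∑ i ∈ T, y i).subset ?_).bddAbove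
  rintro _ ⟨S, -, rfl⟩
  exact ⟨S, rfl⟩

/-- Strong duality: for nonnegative entries some dual feasible pair has value at most the sum of
the `k` largest entries. -/
theorem exists_dual_feasible_le_topK {m k : ℕ} (hk : 1 ≤ k) (hkm : k ≤ m) {y : Fin m → ℝ}
    (hy : ∀ i, 0 ≤ y i) :
    ∃ (u : ℝ) (v : Fin m → ℝ), 0 ≤ u ∧ (∀ i, 0 ≤ v i) ∧ (∀ i, y i ≤ v i + u) ∧
      (k : ℝ) * u + ∑ i, v i ≤ topK y k := by
  obtain ⟨T, hT, hmax⟩ := Finset.exists_max_image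
    (Finset.powersetCard k (Finset.univ : Finset (Fin m))) (fun T => ∑ i ∈ T, y i)
    (Finset.powersetCard_nonempty.2 (by simpa using hkm))
  obtain ⟨-, rfl⟩ := Finset.mem_powersetCard.1 hT
  obtain ⟨a, haT, hmin⟩ := Finset.exists_min_image T y (Finset.card_pos.1 hk)
  have hout : ∀ i ∉ T, y i ≤ y a := by
    intro i hi
    have hi' : i ∉ T.erase a := fun h => hi (Finset.mem_of_mem_erase h)
    have hswap := hmax (insert i (T.erase a)) (Finset.mem_powersetCard.2
      ⟨Finset.subset_univ _, by
        rw [Finset.card_insert_of_notMem hi', Finset.card_erase_add_one haT]⟩)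
    simp only [Finset.sum_insert hi'] at hswap
    linarith [Finset.add_sum_erase T y haT]
  refine ⟨y a, fun i => if i ∈ T then y i - y a else 0, hy a, fun i => ?_, fun i => ?_, ?_⟩
  · dsimp only
    split_ifs with h
    · exact sub_nonneg.2 (hmin i h)
    · exact le_rfl
  · dsimp only
    split_ifs with h
    · simp
    · simpa using hout i h
  · refine le_trans (le_of_eq ?_) (sum_le_topK y T)
    rw [Finset.sum_ite_mem, Finset.univ_inter, Finset.sum_sub_distrib, Finset.sum_const,
      nsmul_eq_mul]
    ring

/-- ε-constraint reformulation of the sustainability constraint: the sum of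
the `k` largest of the scores `⟨s i, x⟩` is at most `γ` iff there is a dual
feasible pair `(u, v)` with value at most `γ`. -/
theorem epsilon_constraint_reformulation (n m : ℕ) (hn : 0 < n) (hm : 0 < m)
    (k : ℕ) (hk1 : 1 ≤ k) (hkm : k ≤ m)
    (s : Fin m → Fin n → ℝ) (hs : ∀ i j, 0 ≤ s i j)
    (x : Fin n → ℝ) (hx : ∀ j, 0 ≤ x j) (γ : ℝ) :
    topK (fun i => ∑ j, s i j * x j) k ≤ γ ↔
      ∃ (u : ℝ) (v : Fin m → ℝ), 0 ≤ u ∧ (∀ i, 0 ≤ v i) ∧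
        (∀ i, (∑ j, s i j * x j) ≤ v i + u) ∧ (k : ℝ) * u + ∑ i, v i ≤ γ := by
  constructor
  · intro h
    obtain ⟨u, v, hu, hv, hyv, hle⟩ := exists_dual_feasible_le_topK hk1 hkm
      (y := fun i => ∑ j, s i j * x j)
      fun i => Finset.sum_nonneg fun j _ => mul_nonneg (hs i j) (hx j)
    exact ⟨u, v, hu, hv, hyv, hle.trans h⟩
  · rintro ⟨u, v, -, hv, hyv, hle⟩
    exact (topK_le_of_dual_feasible hkm hv hyv).trans hle
end

section
/- Let E be a type, X : Set E, p a positive natural number, f : Fin p → E → ℝ a family of objective functions, and λ : Fin p → ℝ with λ h > 0 for every h. Suppose x̂ ∈ X is an optimal solution of the weighted-sum problem, i.e. ∑_h λ h * f h x̂ ≤ ∑_h λ h * f h x for every x ∈ X. Then for every index j there exists ε : Fin p → ℝ such that x̂ is an optimal solution of the ε-constraint problem for j: x̂ ∈ X, f h x̂ ≤ ε h for every h ≠ j, and f j x̂ ≤ f j x for every x ∈ X satisfying f h x ≤ ε h for all h ≠ j. -/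
/-- If `x̂` solves the weighted-sum problem with strictly positive weights,
then for every index `j` there are bounds `ε` making `x̂` an optimal solution
of the ε-constraint problem for `j`. -/
theorem weightedSum_to_epsilonConstraint {E : Type*} (X : Set E) (p : ℕ)
    (hp : 0 < p) (f : Fin p → E → ℝ) (lam : Fin p → ℝ) (hlam : ∀ h, 0 < lam h)
    (xhat : E) (hxhat : xhat ∈ X)
    (hopt : ∀ x ∈ X, (∑ h, lam h * f h xhat) ≤ ∑ h, lam h * f h x) :
    ∀ j : Fin p, ∃ ε : Fin p → ℝ,
      (∀ h, h ≠ j → f h xhat ≤ ε h) ∧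
      ∀ x ∈ X, (∀ h, h ≠ j → f h x ≤ ε h) → f j xhat ≤ f j x := by
  intro j
  refine ⟨fun h => f h xhat, fun _ _ => le_rfl, fun x hx hfeas => ?_⟩
  by_contra! hlt
  refine (hopt x hx).not_gt (Finset.sum_lt_sum (fun h _ => ?_)
    ⟨j, Finset.mem_univ j, mul_lt_mul_of_pos_left hlt (hlam j)⟩)
  refine mul_le_mul_of_nonneg_left ?_ (hlam h).le
  obtain rfl | hne := eq_or_ne h j
  · exact hlt.le
  · exact hfeas h hne
end

section
/- Let n, p be positive natural numbers, X ⊆ ℝⁿ (i.e., X : Set (Fin n → ℝ)) a convex set, and f : Fin p → (Fin n → ℝ) → ℝ a family of functions each convex on ℝⁿ. Fix an index j and bounds ε : Fin p → ℝ, and suppose x̂ is an optimal solution of the ε-constraint problem for j: x̂ ∈ X, f h x̂ ≤ ε h for all h ≠ j, and f j x̂ ≤ f j x for every x ∈ X with f h x ≤ ε h for all h ≠ j. Then there exists λ : Fin p → ℝ with λ h ≥ 0 for all h and λ ≠ 0 such that x̂ is an optimal solution of the weighted-sum problem: ∑_h λ h * f h x̂ ≤ ∑_h λ h * f h x for every x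 ∈ X. -/
/-- A weakly minimal point of a convex upper set in `ι → ℝ` minimizes some nonzero functional with
nonnegative weights. -/
theorem exists_nonneg_weights_of_isUpperSet {ι : Type*} [Fintype ι] {T : Set (ι → ℝ)}
    (hT : Convex ℝ T) (hup : IsUpperSet T) {y : ι → ℝ} (hy : y ∈ T)
    (hmin : ∀ z ∈ T, ∃ i, y i ≤ z i) :
    ∃ lam : ι → ℝ, (∀ i, 0 ≤ lam i) ∧ lam ≠ 0 ∧
      ∀ z ∈ T, (∑ i, lam i * y i) ≤ ∑ i, lam i * z i := by
  classical
  have hdisj : Disjoint (Set.univ.pi fun i => Set.Iio (y i)) T := by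
    refine Set.disjoint_left.2 fun z hz hzT => ?_
    obtain ⟨i, hi⟩ := hmin z hzT
    exact (hz i (Set.mem_univ i)).not_ge hi
  obtain ⟨φ, u, hφs, hφT⟩ := geometric_hahn_banach_open
    (convex_pi fun i _ => convex_Iio (y i))
    (isOpen_set_pi Set.finite_univ fun i _ => isOpen_Iio) hT hdisj
  have hφ : ∀ z, φ z = ∑ i, φ (Pi.single i 1) * z i := fun z => by
    conv_lhs => rw [pi_eq_sum_univ' z]
    simp [map_sum, mul_comm]
  have hbelow : ∀ r : ℝ, 0 < r → φ y - r * φ 1 < u := fun r hr => by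
    have h := hφs (y - r • 1) fun i _ => by simp [hr]
    simpa using h
  have hy_u : φ y ≤ u := by
    have hlim : Filter.Tendsto (fun r : ℝ => φ y - r * φ 1) (nhdsWithin 0 (Set.Ioi 0))
        (nhds (φ y)) := by
      have hc : Continuous fun r : ℝ => φ y - r * φ 1 := by fun_prop
      simpa using (hc.tendsto 0).mono_left nhdsWithin_le_nhds
    exact le_of_tendsto hlim (by
      filter_upwards [self_mem_nhdsWithin] with r hr using (hbelow r hr).le)
  refine ⟨fun i => φ (Pi.single i 1), fun i => ?_, fun h0 => ?_, fun z hz => ?_⟩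
  · by_contra! hneg
    have hmem : y + (1 / -φ (Pi.single i 1)) • Pi.single i (1 : ℝ) ∈ T := by
      refine hup (le_add_of_nonneg_right (smul_nonneg ?_ ?_)) hy
      · exact one_div_nonneg.2 (by linarith)
      · exact Pi.single_nonneg.2 zero_le_one
    have h := hφT _ hmem
    have hval : 1 / -φ (Pi.single i 1) * φ (Pi.single i 1) = -1 := by
      field_simp [hneg.ne]
    rw [map_add, map_smul, smul_eq_mul, hval] at h
    have := hφT y hy
    linarith
  · have hzero : ∀ z, φ z = 0 := fun z => by
      rw [hφ z]
      exact Finset.sum_eq_zero fun i _ => by simp [congrFun h0 i]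
    have h₁ := hbelow 1 one_pos
    have h₂ := hφT y hy
    simp only [hzero] at h₁ h₂
    linarith
  · rw [← hφ y, ← hφ z]
    exact hy_u.trans (hφT z hz)

/-- If `X` is convex, the objectives are convex, and `x̂` solves the
ε-constraint problem for some index `j`, then there exist nonnegative, not
all zero, weights `λ` making `x̂` an optimal solution of the weighted-sum
problem. -/
theorem epsilonConstraint_to_weightedSum (n p : ℕ) (hn : 0 < n) (hp : 0 < p)
    (X : Set (Fin n → ℝ)) (hX : Convex ℝ X)
    (f : Fin p → (Fin n → ℝ) → ℝ)
    (hf : ∀ h, ∀ (x y : Fin n → ℝ) (t : ℝ), 0 ≤ t → t ≤ 1 →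
      f h (t • x + (1 - t) • y) ≤ t * f h x + (1 - t) * f h y)
    (j : Fin p) (ε : Fin p → ℝ) (xhat : Fin n → ℝ)
    (hxhat : xhat ∈ X) (hfeas : ∀ h, h ≠ j → f h xhat ≤ ε h)
    (hopt : ∀ x ∈ X, (∀ h, h ≠ j → f h x ≤ ε h) → f j xhat ≤ f j x) :
    ∃ lam : Fin p → ℝ, (∀ h, 0 ≤ lam h) ∧ lam ≠ 0 ∧
      ∀ x ∈ X, (∑ h, lam h * f h xhat) ≤ ∑ h, lam h * f h x := by
  obtain ⟨lam, hlam, hne, hle⟩ := exists_nonneg_weights_of_isUpperSet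
    (T := {y : Fin p → ℝ | ∃ x ∈ X, ∀ h, f h x ≤ y h}) (y := fun h => f h xhat)
    (by
      rintro y ⟨x, hx, hxy⟩ z ⟨w, hw, hwz⟩ a b ha hb hab
      obtain rfl : b = 1 - a := by linarith
      refine ⟨a • x + (1 - a) • w, hX hx hw ha hb hab, fun h => ?_⟩
      exact (hf h x w a ha (by linarith)).trans
        (add_le_add (mul_le_mul_of_nonneg_left (hxy h) ha)
          (mul_le_mul_of_nonneg_left (hwz h) hb)))
    (fun y z hyz ⟨x, hx, hxy⟩ => ⟨x, hx, fun h => (hxy h).trans (hyz h)⟩)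
    ⟨xhat, hxhat, fun _ => le_rfl⟩
    (by
      rintro z ⟨x, hx, hxz⟩
      by_contra! hlt
      have hx_lt : ∀ h, f h x < f h xhat := fun h => (hxz h).trans_lt (hlt h)
      exact (hx_lt j).not_ge (hopt x hx fun h hh => (hx_lt h).le.trans (hfeas h hh)))
  exact ⟨lam, hlam, hne, fun x hx => hle (fun h => f h x) ⟨x, hx, fun _ => le_rfl⟩⟩
end
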